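/- Let α > 0 and let m = (m₁,m₂,m₃) : ℝ → S² be locally absolutely continuous with lim_{x→−∞} m(x) = (−1,0,0) and lim_{x→+∞} m(x) = (1,0,0). Then E_α(m) = ∫_ℝ |m′(x)|² dx + α ∫_ℝ (m₂(x)² + m₃(x)²) dx ≥ 4√α. -/

import Mathlib

open MeasureTheory Filter

/-- `f` is locally absolutely continuous on ℝ with a.e. derivative `f'`:
`f'` is locally integrable and `f(b) − f(a) = ∫_a^b f'` for all `a, b`. -/
def LocAC (f f' : ℝ → ℝ) : Prop :=
  (∀ a b : ℝ, IntervalIntegrable f' volume a b) ∧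
  ∀ a b : ℝ, f b - f a = ∫ x in a..b, f' x

theorem LocAC.continuous {f f' : ℝ → ℝ} (h : LocAC f f') : Continuous f := by
  have hf : f = fun x => f 0 + ∫ t in (0 : ℝ)..x, f' t := by
    funext x
    linarith [h.2 0 x]
  rw [hf]
  exact continuous_const.add (intervalIntegral.continuous_primitive h.1 0)

theorem LocAC.ae_hasDerivAt {f f' : ℝ → ℝ} (h : LocAC f f') :
    ∀ᵐ x, HasDerivAt f (f' x) x := by
  have hf : f = fun x => f 0 + ∫ t in (0 : ℝ)..x, f' t := by
    funext x
    linarith [h.2 0 x]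
  have hloc : LocallyIntegrable f' volume := by
    intro x
    refine ⟨Set.Ioc (x - 1) (x + 1), Ioc_mem_nhds (by linarith) (by linarith), ?_⟩
    exact (h.1 (x - 1) (x + 1)).1
  filter_upwards [_root_.LocallyIntegrable.ae_hasDerivAt_integral hloc] with x hx
  rw [hf]
  exact (hx 0).const_add (f 0)

/-- The variation between the two limits is controlled by the total integral of the derivative. -/
theorem LocAC.enorm_sub_le_lintegral {f f' : ℝ → ℝ} (h : LocAC f f') {a b : ℝ}
    (ha : Tendsto f atBot (nhds a)) (hb : Tendsto f atTop (nhds b)) :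
    ‖b - a‖ₑ ≤ ∫⁻ x, ‖f' x‖ₑ := by
  have hlim : Tendsto (fun R : ℝ => ‖f R - f (-R)‖ₑ) atTop (nhds ‖b - a‖ₑ) :=
    (hb.sub (ha.comp tendsto_neg_atTop_atBot)).enorm
  refine le_of_tendsto hlim ?_
  filter_upwards [eventually_ge_atTop 0] with R hR
  rw [h.2, intervalIntegral.integral_of_le (by linarith)]
  exact (enorm_integral_le_lintegral_enorm _).trans (setLIntegral_le_lintegral _ _)

/-- The pointwise Modica–Mortola inequality for a vector `d` tangent to the sphere at `m`. -/
theorem two_mul_abs_le_of_tangent {s m₁ m₂ m₃ d₁ d₂ d₃ : ℝ}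
    (hm : m₁ ^ 2 + m₂ ^ 2 + m₃ ^ 2 = 1) (hd : m₁ * d₁ + m₂ * d₂ + m₃ * d₃ = 0) :
    2 * s * |d₁| ≤ d₁ ^ 2 + d₂ ^ 2 + d₃ ^ 2 + s ^ 2 * (m₂ ^ 2 + m₃ ^ 2) := by
  have hcs : d₁ ^ 2 ≤ (m₂ ^ 2 + m₃ ^ 2) * (d₁ ^ 2 + d₂ ^ 2 + d₃ ^ 2) := by
    have h₁ : (m₁ * d₁) ^ 2 = (m₂ * d₂ + m₃ * d₃) ^ 2 := by
      rw [show m₁ * d₁ = -(m₂ * d₂ + m₃ * d₃) by linarith]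
      ring
    have h₂ : d₁ ^ 2 = (m₁ * d₁) ^ 2 + (m₂ ^ 2 + m₃ ^ 2) * d₁ ^ 2 := by
      linear_combination (-d₁ ^ 2) * hm
    nlinarith [sq_nonneg (m₂ * d₃ - m₃ * d₂)]
  refine abs_le_of_sq_le_sq' ?_ (by positivity) |>.2
  have h₃ : (2 * s * |d₁|) ^ 2 = 4 * s ^ 2 * d₁ ^ 2 := by
    rw [mul_pow, sq_abs]
    ring
  rw [h₃]
  nlinarith [mul_le_mul_of_nonneg_left hcs (by positivity : 0 ≤ 4 * s ^ 2),
    sq_nonneg (d₁ ^ 2 + d₂ ^ 2 + d₃ ^ 2 - s ^ 2 * (m₂ ^ 2 + m₃ ^ 2))]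

/-- for `α > 0` and a locally absolutely continuous `m : ℝ → S²` with
`m(∓∞) = (∓1,0,0)`, the wall energy satisfies
`E_α(m) = ∫_ℝ |m′|² + α ∫_ℝ (m₂² + m₃²) ≥ 4 √α` (in `ℝ≥0∞`, since the energy may be
infinite). -/
theorem statement13 (α : ℝ) (hα : 0 < α) (m₁ m₂ m₃ d₁ d₂ d₃ : ℝ → ℝ)
    (h₁ : LocAC m₁ d₁) (h₂ : LocAC m₂ d₂) (h₃ : LocAC m₃ d₃)
    (hsphere : ∀ x, m₁ x ^ 2 + m₂ x ^ 2 + m₃ x ^ 2 = 1)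
    (htop : Tendsto (fun x => (m₁ x, m₂ x, m₃ x)) atTop (nhds (1, 0, 0)))
    (hbot : Tendsto (fun x => (m₁ x, m₂ x, m₃ x)) atBot (nhds (-1, 0, 0))) :
    ENNReal.ofReal (4 * Real.sqrt α) ≤
      (∫⁻ x : ℝ, ENNReal.ofReal (d₁ x ^ 2 + d₂ x ^ 2 + d₃ x ^ 2)) +
        ENNReal.ofReal α * ∫⁻ x : ℝ, ENNReal.ofReal (m₂ x ^ 2 + m₃ x ^ 2) := by
  have hm₁top : Tendsto m₁ atTop (nhds 1) := htop.fst_nhds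
  have hm₁bot : Tendsto m₁ atBot (nhds (-1)) := hbot.fst_nhds
  have htangent : ∀ᵐ x, m₁ x * d₁ x + m₂ x * d₂ x + m₃ x * d₃ x = 0 := by
    filter_upwards [h₁.ae_hasDerivAt, h₂.ae_hasDerivAt, h₃.ae_hasDerivAt] with x hx₁ hx₂ hx₃
    have hsum := ((hx₁.fun_pow 2).fun_add (hx₂.fun_pow 2)).fun_add (hx₃.fun_pow 2)
    simp only [hsphere] at hsum
    have hzero := hsum.unique (hasDerivAt_const x 1)
    norm_num at hzero
    linarith
  have hmeas : Measurable fun x => ENNReal.ofReal (m₂ x ^ 2 + m₃ x ^ 2) :=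
    ((h₂.continuous.pow 2).add (h₃.continuous.pow 2)).measurable.ennreal_ofReal
  calc
    ENNReal.ofReal (4 * Real.sqrt α)
      = ENNReal.ofReal (2 * Real.sqrt α) * ‖(1 : ℝ) - -1‖ₑ := by
        rw [Real.enorm_eq_ofReal (by norm_num), ← ENNReal.ofReal_mul (by positivity)]
        congr 1
        ring
    _ ≤ ENNReal.ofReal (2 * Real.sqrt α) * ∫⁻ x, ‖d₁ x‖ₑ := by
        gcongr
        exact h₁.enorm_sub_le_lintegral hm₁bot hm₁top
    _ = ∫⁻ x, ENNReal.ofReal (2 * Real.sqrt α) * ‖d₁ x‖ₑ :=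
        (lintegral_const_mul' _ _ ENNReal.ofReal_ne_top).symm
    _ ≤ ∫⁻ x, (ENNReal.ofReal (d₁ x ^ 2 + d₂ x ^ 2 + d₃ x ^ 2) +
          ENNReal.ofReal α * ENNReal.ofReal (m₂ x ^ 2 + m₃ x ^ 2)) := by
        refine lintegral_mono_ae ?_
        filter_upwards [htangent] with x hx
        rw [Real.enorm_eq_ofReal_abs, ← ENNReal.ofReal_mul (by positivity),
          ← ENNReal.ofReal_mul hα.le, ← ENNReal.ofReal_add (by positivity) (by positivity)]
        apply ENNReal.ofReal_le_ofReal
        simpa only [Real.sq_sqrt hα.le] using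
          two_mul_abs_le_of_tangent (s := Real.sqrt α) (hsphere x) hx
    _ = _ := by
        rw [lintegral_add_right _ (hmeas.const_mul _), lintegral_const_mul' _ _ ENNReal.ofReal_ne_top]
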